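/- For every k from 1 to 4 let M'_k be the Pauli measurement on the d-inflation G' of a graph G that agrees with a given measurement M_k on all power vertices and measures X on every chain vertex, and let C'_k = χ_k S'_k with S'_k the inflated stabilizer element corresponding to S_k = χ_k M_k. If the original measurements {M_k} satisfy the even-occurrence condition (every non-identity Pauli occurs an even number of times at each vertex) and each M_k = χ_k S_k with ∏_k χ_k = −1, then: (a) each C'_k is a submeasurement of M'_k; (b) at each vertex of G', every non-identity Pauli occurs an even number of times among the C'_k; (c) ∏_k C'_k = −𝟙. -/

import Mathlib

open scoped Classical

inductive Pauli | I | X | Y | Z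
deriving DecidableEq

noncomputable def pauliMat : Pauli → Matrix (Fin 2) (Fin 2) ℂ
  | Pauli.I => 1
  | Pauli.X => !![0, 1; 1, 0]
  | Pauli.Y => !![0, -Complex.I; Complex.I, 0]
  | Pauli.Z => !![1, 0; 0, -1]

noncomputable def pauliProd {V : Type} [Fintype V] [DecidableEq V] (σ : V → Pauli) :
    Matrix (V → Fin 2) (V → Fin 2) ℂ :=
  fun f g => ∏ v, pauliMat (σ v) (f v) (g v)

noncomputable def graphGen {V : Type} [Fintype V] [DecidableEq V] (G : SimpleGraph V) (v : V) :
    Matrix (V → Fin 2) (V → Fin 2) ℂ :=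
  pauliProd (fun u => if u = v then Pauli.X else if G.Adj u v then Pauli.Z else Pauli.I)

noncomputable def graphState {V : Type} [Fintype V] [DecidableEq V] (G : SimpleGraph V) :
    (V → Fin 2) → ℂ :=
  fun f => (-1 : ℂ) ^ (∑ e ∈ G.edgeFinset,
      Sym2.lift ⟨fun u v => (f u : ℕ) * (f v : ℕ), fun u v => Nat.mul_comm _ _⟩ e) /
    (Real.sqrt (2 ^ Fintype.card V) : ℂ)

noncomputable def expVal {V : Type} [Fintype V] [DecidableEq V]
    (ψ : (V → Fin 2) → ℂ) (P : Matrix (V → Fin 2) (V → Fin 2) ℂ) : ℂ :=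
  ∑ f, ∑ g, (starRingEnd ℂ) (ψ f) * P f g * ψ g

/-- The original graph on `V` determined by an oriented edge list `e`. -/
def origGraph {V : Type} (m : ℕ) (e : Fin m → V × V) : SimpleGraph V :=
  SimpleGraph.fromRel (fun u v => ∃ j, e j = (u, v))

/-- Adjacency seed relation of the `d`-inflated graph: each oriented edge `e j` is
replaced by a chain of `2d` chain vertices `(j, 0), …, (j, 2d - 1)` joining its
endpoints. -/
def inflAdj {V : Type} (m d : ℕ) (e : Fin m → V × V) :
    (V ⊕ (Fin m × Fin (2 * d))) → (V ⊕ (Fin m × Fin (2 * d))) → Prop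
  | Sum.inl u, Sum.inr (j, r) =>
      ((e j).1 = u ∧ (r : ℕ) = 0) ∨ ((e j).2 = u ∧ (r : ℕ) = 2 * d - 1)
  | Sum.inr (j, r), Sum.inr (j', r') => j = j' ∧ (r : ℕ) + 1 = (r' : ℕ)
  | _, _ => False

/-- The `d`-inflated graph. -/
def inflGraph {V : Type} (m d : ℕ) (e : Fin m → V × V) :
    SimpleGraph (V ⊕ (Fin m × Fin (2 * d))) :=
  SimpleGraph.fromRel (inflAdj m d e)

/-- The stabilizer generator of the inflated graph state at the chain vertex of
edge `j` with (0-indexed) position `r`; `1` if `r` is out of range. -/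
noncomputable def chainGen {V : Type} [Fintype V] [DecidableEq V] (m d : ℕ)
    (e : Fin m → V × V) (j : Fin m) (r : ℕ) :
    Matrix ((V ⊕ (Fin m × Fin (2 * d))) → Fin 2) ((V ⊕ (Fin m × Fin (2 * d))) → Fin 2) ℂ :=
  if h : r < 2 * d then graphGen (inflGraph m d e) (Sum.inr (j, ⟨r, h⟩)) else 1

/-- The inflated generator element
`f_u = g'_u ∏_{(u,v) ∈ E} ∏_{s=1}^{d} g'_{(2s)_{(u,v)}}`; the chain vertex at
distance `2s` from `u` has 0-indexed position `2s - 1` if `e j = (u, v)` and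
`2d - 2s` if `e j = (v, u)`. -/
noncomputable def inflGen {V : Type} [Fintype V] [DecidableEq V] (m d : ℕ)
    (e : Fin m → V × V) (u : V) :
    Matrix ((V ⊕ (Fin m × Fin (2 * d))) → Fin 2) ((V ⊕ (Fin m × Fin (2 * d))) → Fin 2) ℂ :=
  graphGen (inflGraph m d e) (Sum.inl u) *
    ((List.finRange m).map (fun j =>
      ((List.range d).map (fun s =>
        if (e j).1 = u then chainGen m d e j (2 * s + 1)
        else if (e j).2 = u then chainGen m d e j (2 * d - 2 * s - 2)
        else 1)).prod)).prod

/-- The inflated measurement: the original Pauli on power vertices, `X` on all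
chain vertices. -/
def inflMeas {V : Type} {m d : ℕ} (M : V → Pauli) : (V ⊕ (Fin m × Fin (2 * d))) → Pauli :=
  Sum.elim M (fun _ => Pauli.X)

/-- The tensor product of a family of `2 × 2` matrices, multiplicative in the family. -/
noncomputable def matTensor {V : Type} [Fintype V] [DecidableEq V] :
    (V → Matrix (Fin 2) (Fin 2) ℂ) →* Matrix (V → Fin 2) (V → Fin 2) ℂ where
  toFun A := fun f g => ∏ v, A v (f v) (g v)
  map_one' := by
    ext f g
    by_cases h : f = g
    · subst h
      simp
    · obtain ⟨v, hv⟩ := Function.ne_iff.mp h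
      rw [Matrix.one_apply_ne h]
      exact Finset.prod_eq_zero (Finset.mem_univ v) (by simp [hv])
  map_mul' A B := by
    ext f g
    change ∏ v, (A v * B v) (f v) (g v) =
      ∑ x : V → Fin 2, (∏ v, A v (f v) (x v)) * ∏ v, B v (x v) (g v)
    simp only [Matrix.mul_apply, Finset.prod_univ_sum, Fintype.piFinset_univ,
      Finset.prod_mul_distrib]

theorem matTensor_apply {V : Type} [Fintype V] [DecidableEq V]
    (A : V → Matrix (Fin 2) (Fin 2) ℂ) (f g : V → Fin 2) :
    matTensor A f g = ∏ v, A v (f v) (g v) := rfl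

theorem pauliProd_eq_matTensor {V : Type} [Fintype V] [DecidableEq V] (σ : V → Pauli) :
    pauliProd σ = matTensor (fun v => pauliMat (σ v)) := rfl

theorem matTensor_smul {V : Type} [Fintype V] [DecidableEq V] (c : V → ℂ)
    (A : V → Matrix (Fin 2) (Fin 2) ℂ) :
    matTensor (fun v => c v • A v) = (∏ v, c v) • matTensor A := by
  ext f g
  simp [matTensor_apply, Finset.prod_mul_distrib]

theorem matTensor_sumElim_congr {V W : Type} [Fintype V] [DecidableEq V] [Fintype W]
    [DecidableEq W] {A A' : V → Matrix (Fin 2) (Fin 2) ℂ} {c : ℂ}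
    (h : matTensor A = c • matTensor A') (B : W → Matrix (Fin 2) (Fin 2) ℂ) :
    matTensor (Sum.elim A B) = c • matTensor (Sum.elim A' B) := by
  ext f g
  have := congrFun (congrFun h (fun v => f (Sum.inl v))) (fun v => g (Sum.inl v))
  simp only [matTensor_apply, Matrix.smul_apply, smul_eq_mul] at this
  simp [matTensor_apply, Fintype.prod_sum_type, this, mul_assoc]

theorem pauliMat_mul_self (p : Pauli) : pauliMat p * pauliMat p = 1 := by
  cases p <;> ext i j <;> fin_cases i <;> fin_cases j <;> simp [pauliMat]

theorem pauliMat_X_mul_Z :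
    pauliMat Pauli.X * pauliMat Pauli.Z = (-1 : ℂ) • (pauliMat Pauli.Z * pauliMat Pauli.X) := by
  ext i j; fin_cases i <;> fin_cases j <;> simp [pauliMat]

theorem pauliMat_Z_mul_X :
    pauliMat Pauli.Z * pauliMat Pauli.X = (-1 : ℂ) • (pauliMat Pauli.X * pauliMat Pauli.Z) := by
  ext i j; fin_cases i <;> fin_cases j <;> simp [pauliMat]

/-- The tensor factors of the stabilizer generator of `G` at `v`. -/
noncomputable def genFactor {V : Type} [DecidableEq V] (G : SimpleGraph V) (v : V) :
    V → Matrix (Fin 2) (Fin 2) ℂ :=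
  fun u => pauliMat (if u = v then Pauli.X else if G.Adj u v then Pauli.Z else Pauli.I)

theorem graphGen_eq_matTensor {V : Type} [Fintype V] [DecidableEq V] (G : SimpleGraph V) (v : V) :
    graphGen G v = matTensor (genFactor G v) := rfl

theorem graphGen_commute {V : Type} [Fintype V] [DecidableEq V] (G : SimpleGraph V) (u v : V) :
    Commute (graphGen G u) (graphGen G v) := by
  by_cases huv : u = v
  · rw [huv]
  have hvu : v ≠ u := Ne.symm huv
  let c (x w : V) : ℂ := if w = x then (if G.Adj u v then -1 else 1) else 1
  have h : genFactor G u * genFactor G v =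
      fun w => (c u w * c v w) • (genFactor G v * genFactor G u) w := by
    funext w
    simp only [Pi.mul_apply, genFactor, c]
    by_cases hu : w = u
    · subst hu
      by_cases ha : G.Adj w v
      · simp [huv, ha, pauliMat_X_mul_Z]
      · simp [huv, ha, pauliMat]
    · by_cases hv : w = v
      · subst hv
        by_cases ha : G.Adj u w
        · simp [hvu, ha, ha.symm, pauliMat_Z_mul_X]
        · have ha' : ¬ G.Adj w u := fun h => ha h.symm
          simp [hvu, ha, ha', pauliMat]
      · by_cases h1 : G.Adj w u <;> by_cases h2 : G.Adj w v <;> simp [hu, hv, h1, h2, pauliMat]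
  have hc : ∏ w, (c u w * c v w) = 1 := by
    rw [Finset.prod_mul_distrib]
    simp only [c, Finset.prod_ite_eq', Finset.mem_univ, if_true]
    split_ifs <;> norm_num
  rw [commute_iff_eq, graphGen_eq_matTensor, graphGen_eq_matTensor, ← map_mul, ← map_mul, h,
    matTensor_smul, hc, one_smul]

theorem graphGen_mul_self {V : Type} [Fintype V] [DecidableEq V] (G : SimpleGraph V) (v : V) :
    graphGen G v * graphGen G v = 1 := by
  rw [graphGen_eq_matTensor, ← map_mul, ← map_one matTensor]
  exact congrArg matTensor (funext fun w => pauliMat_mul_self _)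

theorem List.Nodup.prod_map_eq_single {α M : Type*} [Monoid M] {l : List α} (hl : l.Nodup)
    (a : α) (f : α → M) (h : ∀ x ∈ l, x ≠ a → f x = 1) (ha : a ∈ l) :
    (l.map f).prod = f a := by
  induction l with
  | nil => simp at ha
  | cons b l ih =>
    rw [List.nodup_cons] at hl
    rw [List.map_cons, List.prod_cons]
    by_cases hb : b = a
    · subst hb
      rw [List.prod_eq_one, mul_one]
      intro x hx
      obtain ⟨y, hy, rfl⟩ := List.mem_map.mp hx
      exact h y (List.mem_cons_of_mem _ hy) (fun hyb => hl.1 (hyb ▸ hy))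
    · rw [h b List.mem_cons_self hb, one_mul]
      exact ih hl.2 (fun x hx => h x (List.mem_cons_of_mem _ hx))
        ((List.mem_cons.mp ha).resolve_left (Ne.symm hb))

theorem List.Nodup.prod_map_ite_eq {α M : Type*} [Monoid M] [DecidableEq α] {l : List α}
    (hl : l.Nodup) (a : α) (x : M) :
    (l.map (fun b => if a = b then x else 1)).prod = if a ∈ l then x else 1 := by
  split_ifs with ha
  · rw [hl.prod_map_eq_single a _ (fun b _ hb => if_neg (Ne.symm hb)) ha, if_pos rfl]
  · refine List.prod_eq_one fun y hy => ?_
    obtain ⟨b, hb, rfl⟩ := List.mem_map.mp hy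
    have hab : a ≠ b := by
      rintro rfl
      exact ha hb
    exact if_neg hab

theorem List.prod_map_range_ite {M : Type*} [Monoid M] (n : ℕ) (p : ℕ → Prop) [DecidablePred p]
    (x : M) : ((List.range n).map (fun s => if p s then x else 1)).prod =
      x ^ ((Finset.range n).filter p).card := by
  induction n with
  | zero => simp
  | succ n ih =>
    rw [List.range_succ, List.map_append, List.prod_append, ih, Finset.range_add_one,
      Finset.filter_insert]
    split_ifs with h <;> simp [h, pow_succ]

theorem List.prod_map_smul_matrix {α n : Type*} [Fintype n] [DecidableEq n] (l : List α)
    (c : α → ℂ) (a : α → Matrix n n ℂ) :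
    (l.map (fun k => c k • a k)).prod = (l.map c).prod • (l.map a).prod := by
  induction l with
  | nil => simp
  | cons b l ih => simp only [List.map_cons, List.prod_cons, ih, smul_mul_smul_comm]

theorem list_prod_apply {α V M : Type*} [Monoid M] (l : List α) (F : α → V → M) (v : V) :
    (l.map F).prod v = (l.map (fun a => F a v)).prod := by
  simpa [Function.comp_def] using map_list_prod (Pi.evalMonoidHom (fun _ : V => M) v) (l.map F)

theorem matTensor_list_prod {α V : Type} [Fintype V] [DecidableEq V] (l : List α)
    (F : α → V → Matrix (Fin 2) (Fin 2) ℂ) :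
    (l.map (fun a => matTensor (F a))).prod =
      matTensor (fun v => (l.map (fun a => F a v)).prod) := by
  rw [show (fun v => (l.map (fun a => F a v)).prod) = (l.map F).prod from
    funext fun v => (list_prod_apply l F v).symm, map_list_prod, List.map_map]
  rfl

open scoped IsMulCommutative in
/-- Involutions commuting pairwise multiply to `1` when each is used an even number of times. -/
theorem prod_commuting_involutions {V M : Type*} [Monoid M] [LinearOrder V] [Fintype V]
    (f : V → M) (hc : ∀ u v, Commute (f u) (f v)) (hsq : ∀ u, f u * f u = 1) {N : ℕ}
    (U : Fin N → Finset V)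
    (heven : ∀ u, Even (Finset.univ.filter (fun k => u ∈ U k)).card) :
    ((List.finRange N).map (fun k => (((U k).sort (· ≤ ·)).map f).prod)).prod = 1 := by
  have := Submonoid.isMulCommutative_closure M (s := Set.range f) (by
    rintro _ ⟨u, rfl⟩ _ ⟨v, rfl⟩
    exact hc u v)
  let F (u : V) : Submonoid.closure (Set.range f) := ⟨f u, Submonoid.subset_closure ⟨u, rfl⟩⟩
  have hF : ∏ k, ∏ u ∈ U k, F u = 1 := by
    have h1 : ∀ k, ∏ u ∈ U k, F u = ∏ u, if u ∈ U k then F u else 1 := fun k => by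
      rw [Finset.prod_ite_mem, Finset.univ_inter]
    simp only [h1]
    rw [Finset.prod_comm]
    refine Finset.prod_eq_one fun u _ => ?_
    rw [← Finset.prod_filter, Finset.prod_const]
    obtain ⟨n, hn⟩ := heven u
    have : F u * F u = 1 := Subtype.ext (hsq u)
    rw [hn, ← two_mul, pow_mul, pow_two, this, one_pow]
  have hk : ∀ k, ((((U k).sort (· ≤ ·)).map f).prod) =
      Submonoid.subtype _ (∏ u ∈ U k, F u) := fun k => by
    have : ∏ u ∈ U k, F u = (((U k).sort (· ≤ ·)).map F).prod := by
      rw [← List.prod_toFinset _ (Finset.sort_nodup _ _), Finset.sort_toFinset]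
    rw [this, map_list_prod, List.map_map]
    rfl
  simp only [hk]
  have := congrArg (Submonoid.subtype _) hF
  rw [map_one, ← List.prod_ofFn, List.ofFn_eq_map, map_list_prod, List.map_map] at this
  exact this

/-- A matrix indexed by `Fin 2` is supported on a shift of the diagonal by `c`. -/
def SupportedOnShift (c : Fin 2) (A : Matrix (Fin 2) (Fin 2) ℂ) : Prop :=
  ∀ a b, A a b ≠ 0 → b = a + c

theorem SupportedOnShift.mul {c c' : Fin 2} {A B : Matrix (Fin 2) (Fin 2) ℂ}
    (hA : SupportedOnShift c A) (hB : SupportedOnShift c' B) :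
    SupportedOnShift (c + c') (A * B) := by
  intro a b h
  rw [Matrix.mul_apply] at h
  obtain ⟨k, -, hk⟩ := Finset.exists_ne_zero_of_sum_ne_zero h
  rw [hB k b (right_ne_zero_of_mul hk), hA a k (left_ne_zero_of_mul hk), add_assoc]

theorem SupportedOnShift.list_prod {α : Type*} (l : List α) (c : α → Fin 2)
    (A : α → Matrix (Fin 2) (Fin 2) ℂ) (h : ∀ x, SupportedOnShift (c x) (A x)) :
    SupportedOnShift (l.map c).sum (l.map A).prod := by
  induction l with
  | nil =>
    intro a b hab
    by_contra hne
    exact hab (by simpa using Matrix.one_apply_ne (fun h => hne (by simp [h])))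
  | cons x l ih => simpa using (h x).mul ih

/-- The bit flip effected by a Pauli matrix. -/
def Pauli.flip : Pauli → Fin 2
  | Pauli.I => 0
  | Pauli.X => 1
  | Pauli.Y => 1
  | Pauli.Z => 0

theorem supportedOnShift_pauliMat (p : Pauli) : SupportedOnShift p.flip (pauliMat p) := by
  intro a b
  cases p <;> fin_cases a <;> fin_cases b <;> simp [pauliMat, Pauli.flip]

theorem pauliMat_zero_flip_ne_zero (p : Pauli) : pauliMat p 0 p.flip ≠ 0 := by
  cases p <;> norm_num [pauliMat, Pauli.flip, Matrix.one_apply]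

/-- If a product of generators over `U` is proportional to a Pauli product, then `U` is the set of
vertices at which that Pauli product flips the bit. -/
theorem mem_iff_flip_of_pauliProd_eq {V : Type} [Fintype V] [LinearOrder V] (G : SimpleGraph V)
    (U : Finset V) (σ : V → Pauli) (c : ℂ)
    (h : pauliProd σ = c • ((U.sort (· ≤ ·)).map (graphGen G)).prod) (v : V) :
    v ∈ U ↔ (σ v).flip = 1 := by
  have hne : pauliProd σ (fun _ => 0) (fun v => (σ v).flip) ≠ 0 :=
    Finset.prod_ne_zero_iff.mpr fun v _ => pauliMat_zero_flip_ne_zero _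
  rw [h, show graphGen G = fun u => matTensor (genFactor G u) from rfl, matTensor_list_prod] at hne
  have hv := Finset.prod_ne_zero_iff.mp (right_ne_zero_of_mul hne) v (Finset.mem_univ v)
  have hs := SupportedOnShift.list_prod (U.sort (· ≤ ·)) (fun u => if v = u then 1 else 0)
    (fun u => genFactor G u v) (fun u => by
      have := supportedOnShift_pauliMat
        (if v = u then Pauli.X else if G.Adj v u then Pauli.Z else Pauli.I)
      unfold genFactor
      convert this using 1
      split_ifs <;> rfl) _ _ hv
  rw [← List.sum_toFinset _ (Finset.sort_nodup _ _), Finset.sort_toFinset, Finset.sum_ite_eq] at hs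
  replace hs : (σ v).flip = 0 + if v ∈ U then 1 else 0 := hs
  rw [hs]
  split_ifs with hU <;> simp [hU]

/-- The tensor factors of the stabilizer generator at the chain vertex `(j, r)`. -/
noncomputable def chainFactor {V : Type} [DecidableEq V] (m d : ℕ) (e : Fin m → V × V)
    (j : Fin m) (r : ℕ) : (V ⊕ (Fin m × Fin (2 * d))) → Matrix (Fin 2) (Fin 2) ℂ
  | Sum.inl v =>
      if ((e j).1 = v ∧ r = 0) ∨ ((e j).2 = v ∧ r = 2 * d - 1) then pauliMat Pauli.Z else 1
  | Sum.inr (i, t) =>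
      if i = j then
        if (t : ℕ) = r then pauliMat Pauli.X
        else if (t : ℕ) + 1 = r ∨ r + 1 = (t : ℕ) then pauliMat Pauli.Z else 1
      else 1

theorem chainGen_eq_matTensor {V : Type} [Fintype V] [DecidableEq V] (m d : ℕ)
    (e : Fin m → V × V) (j : Fin m) {r : ℕ} (hr : r < 2 * d) :
    chainGen m d e j r = matTensor (chainFactor m d e j r) := by
  rw [chainGen, dif_pos hr, graphGen_eq_matTensor]
  congr 1
  funext w
  rcases w with v | ⟨i, t⟩
  · simp only [genFactor, chainFactor, inflGraph, SimpleGraph.fromRel_adj, inflAdj]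
    simp only [reduceCtorEq, if_false, ne_eq, not_false_eq_true, true_and, or_false]
    split_ifs <;> rfl
  · simp only [genFactor, chainFactor, inflGraph, SimpleGraph.fromRel_adj, inflAdj]
    simp only [Sum.inr.injEq, Prod.mk.injEq, Fin.ext_iff]
    by_cases hij : (i : ℕ) = j
    · by_cases htr : (t : ℕ) = r
      · simp [hij, htr]
      · simp only [hij, htr, and_false, if_false, true_and, if_true, ne_eq, Sum.inr.injEq,
          Prod.mk.injEq, Fin.ext_iff, not_false_eq_true]
        split_ifs <;> rfl
    · simp [hij, Ne.symm hij, pauliMat]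

/-- The tensor factors of the inflated generator at `u`. -/
noncomputable def inflFactor {V : Type} [DecidableEq V] (m d : ℕ) (e : Fin m → V × V) (u : V) :
    (V ⊕ (Fin m × Fin (2 * d))) → Matrix (Fin 2) (Fin 2) ℂ :=
  Sum.elim (genFactor (origGraph m e) u) (fun q =>
    if (if (q.2 : ℕ) % 2 = 1 then (e q.1).1 else (e q.1).2) = u then pauliMat Pauli.X else 1)

/-- The tensor factors contributed to the inflated generator at `u` by the chain of edge `j`. -/
noncomputable def chainProdFactor {V : Type} [DecidableEq V] (m d : ℕ) (e : Fin m → V × V)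
    (u : V) (j : Fin m) (w : V ⊕ (Fin m × Fin (2 * d))) : Matrix (Fin 2) (Fin 2) ℂ :=
  ((List.range d).map (fun s =>
    if (e j).1 = u then chainFactor m d e j (2 * s + 1) w
    else if (e j).2 = u then chainFactor m d e j (2 * d - 2 * s - 2) w
    else 1)).prod

theorem inflGen_eq_matTensor_mul {V : Type} [Fintype V] [DecidableEq V] (m d : ℕ)
    (e : Fin m → V × V) (u : V) :
    inflGen m d e u = matTensor (fun w => genFactor (inflGraph m d e) (Sum.inl u) w *
      ((List.finRange m).map (fun j => chainProdFactor m d e u j w)).prod) := by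
  rw [inflGen, graphGen_eq_matTensor, ← Pi.mul_def, map_mul, ← matTensor_list_prod]
  congr 3
  funext j
  unfold chainProdFactor
  rw [← matTensor_list_prod]
  congr 1
  refine List.map_congr_left fun s hs => ?_
  rw [List.mem_range] at hs
  split_ifs
  · exact chainGen_eq_matTensor m d e j (by omega)
  · exact chainGen_eq_matTensor m d e j (by omega)
  · exact (map_one matTensor).symm

theorem chainProdFactor_inl {V : Type} [DecidableEq V] (m d : ℕ) (hd : 0 < d)
    (e : Fin m → V × V) (hloop : ∀ j, (e j).1 ≠ (e j).2) (u v : V) (j : Fin m) :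
    chainProdFactor m d e u j (Sum.inl v) =
      if e j = (u, v) ∨ e j = (v, u) then pauliMat Pauli.Z else 1 := by
  have hlast : d - 1 ∈ List.range d := List.mem_range.mpr (by omega)
  have h : chainProdFactor m d e u j (Sum.inl v) = ((List.range d).map (fun s => if d - 1 = s then
      (if e j = (u, v) ∨ e j = (v, u) then pauliMat Pauli.Z else 1) else 1)).prod := by
    unfold chainProdFactor chainFactor
    refine congrArg List.prod (List.map_congr_left fun s hs => ?_)
    rw [List.mem_range] at hs
    have hj := hloop j
    simp only [Prod.ext_iff]
    have h1 : 2 * s + 1 = 2 * d - 1 ↔ d - 1 = s := by omega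
    have h2 : 2 * d - 2 * s - 2 = 0 ↔ d - 1 = s := by omega
    have h3 : ¬ 2 * d - 2 * s - 2 = 2 * d - 1 := by omega
    simp only [h1, h2, h3, Nat.add_eq_zero_iff, one_ne_zero, and_false, false_or, or_false]
    grind
  rw [h, List.nodup_range.prod_map_ite_eq, if_pos hlast]

theorem pauliMat_Z_pow_two : pauliMat Pauli.Z ^ 2 = 1 := by
  rw [pow_two, pauliMat_mul_self]

theorem chainProdFactor_inr {V : Type} [DecidableEq V] (m d : ℕ)
    (e : Fin m → V × V) (hloop : ∀ j, (e j).1 ≠ (e j).2) (u : V) (i j : Fin m)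
    (t : Fin (2 * d)) :
    chainProdFactor m d e u j (Sum.inr (i, t)) =
      if i = j then
        if (if (t : ℕ) % 2 = 1 then (e j).1 else (e j).2) = u then pauliMat Pauli.X
        else if ((e j).1 = u ∧ (t : ℕ) = 0) ∨ ((e j).2 = u ∧ (t : ℕ) = 2 * d - 1)
          then pauliMat Pauli.Z else 1
      else 1 := by
  obtain ⟨t, ht⟩ := t
  unfold chainProdFactor chainFactor
  by_cases hij : i = j
  swap
  · simp [hij]
  simp only [hij, if_true]
  have hj := hloop j
  by_cases h1 : (e j).1 = u
  · have h2 : (e j).2 ≠ u := fun h => hj (h1.trans h.symm)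
    simp only [h1, h2, if_true, true_and, false_and, or_false]
    by_cases hodd : t % 2 = 1
    · rw [List.map_congr_left (g := fun s => if t / 2 = s then pauliMat Pauli.X else 1)
        (fun s _ => by split_ifs <;> first | rfl | omega),
        List.nodup_range.prod_map_ite_eq, if_pos (List.mem_range.mpr (by omega))]
      simp [hodd]
    · rw [List.map_congr_left (g := fun s => if t = 2 * s ∨ t = 2 * s + 2
        then pauliMat Pauli.Z else 1) (fun s _ => by split_ifs <;> first | rfl | omega),
        List.prod_map_range_ite]
      by_cases ht0 : t = 0
      · rw [show (Finset.range d).filter (fun s => t = 2 * s ∨ t = 2 * s + 2) = {0} by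
          ext s; simp only [Finset.mem_filter, Finset.mem_range, Finset.mem_singleton]; omega]
        simp [ht0, h2]
      · rw [show (Finset.range d).filter (fun s => t = 2 * s ∨ t = 2 * s + 2) =
            {t / 2, t / 2 - 1} by
          ext s
          simp only [Finset.mem_filter, Finset.mem_range, Finset.mem_singleton, Finset.mem_insert]
          omega, Finset.card_pair (by omega), pauliMat_Z_pow_two]
        simp [ht0, h2, hodd]
  · by_cases h2 : (e j).2 = u
    · simp only [h1, h2, if_true, if_false, true_and, false_and, false_or]
      by_cases hodd : t % 2 = 1
      · rw [List.map_congr_left (g := fun s => if t + 2 * s + 1 = 2 * d ∨ t + 2 * s + 3 = 2 * d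
          then pauliMat Pauli.Z else 1) (fun s hs => by
            rw [List.mem_range] at hs
            split_ifs <;> first | rfl | omega), List.prod_map_range_ite]
        by_cases htd : t = 2 * d - 1
        · rw [show (Finset.range d).filter
              (fun s => t + 2 * s + 1 = 2 * d ∨ t + 2 * s + 3 = 2 * d) = {0} by
            ext s; simp only [Finset.mem_filter, Finset.mem_range, Finset.mem_singleton]; omega]
          simp [htd, show (2 * d - 1) % 2 = 1 by omega, h1]
        · rw [show (Finset.range d).filter
              (fun s => t + 2 * s + 1 = 2 * d ∨ t + 2 * s + 3 = 2 * d) =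
              {d - (t + 1) / 2, d - 1 - (t + 1) / 2} by
            ext s
            simp only [Finset.mem_filter, Finset.mem_range, Finset.mem_singleton,
              Finset.mem_insert]
            omega, Finset.card_pair (by omega), pauliMat_Z_pow_two]
          simp [htd, h1, hodd]
      · rw [List.map_congr_left (g := fun s => if d - 1 - t / 2 = s then pauliMat Pauli.X else 1)
          (fun s hs => by
            rw [List.mem_range] at hs
            split_ifs <;> first | rfl | omega),
          List.nodup_range.prod_map_ite_eq, if_pos (List.mem_range.mpr (by omega))]
        simp [hodd]
    · have h3 : (if t % 2 = 1 then (e j).1 else (e j).2) ≠ u := by split_ifs <;> assumption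
      simp [h1, h2, h3]

theorem inflGen_eq_matTensor {V : Type} [Fintype V] [DecidableEq V] (m d : ℕ) (hd : 0 < d)
    (e : Fin m → V × V) (hloop : ∀ j, (e j).1 ≠ (e j).2) (hinj : Function.Injective e)
    (hor : ∀ j j', e j ≠ ((e j').2, (e j').1)) (u : V) :
    inflGen m d e u = matTensor (inflFactor m d e u) := by
  rw [inflGen_eq_matTensor_mul]
  congr 1
  funext w
  rcases w with v | ⟨i, t⟩
  · simp only [chainProdFactor_inl m d hd e hloop, inflFactor, Sum.elim_inl, genFactor,
      Sum.inl.injEq]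
    have hinfl : ¬ (inflGraph m d e).Adj (Sum.inl v) (Sum.inl u) := by
      simp [inflGraph, SimpleGraph.fromRel_adj, inflAdj]
    have horig : (origGraph m e).Adj v u ↔ v ≠ u ∧ ∃ j, e j = (u, v) ∨ e j = (v, u) := by
      rw [origGraph, SimpleGraph.fromRel_adj, ← exists_or]
      simp only [or_comm]
    by_cases hj : ∃ j, e j = (u, v) ∨ e j = (v, u)
    · have huv : v ≠ u := by
        rintro rfl
        obtain ⟨j, hj | hj⟩ := hj <;> exact hloop j (by rw [hj])
      obtain ⟨j, hj⟩ := hj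
      rw [(List.nodup_finRange m).prod_map_eq_single j _ (fun x _ hx => if_neg fun h => ?_)
        (List.mem_finRange j), if_pos hj]
      · rw [if_neg huv, if_neg huv, if_neg hinfl, if_pos (horig.mpr ⟨huv, j, hj⟩)]
        simp [pauliMat]
      · rcases hj with hj | hj <;> rcases h with h | h
        · exact hx (hinj (h.trans hj.symm))
        · exact hor x j (by rw [h, hj])
        · exact hor x j (by rw [h, hj])
        · exact hx (hinj (h.trans hj.symm))
    · have hadj : ¬ (origGraph m e).Adj v u := fun h => hj (horig.mp h).2
      rw [List.prod_eq_one, mul_one, if_neg hinfl, if_neg hadj]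
      intro x hx
      obtain ⟨j, -, rfl⟩ := List.mem_map.mp hx
      exact if_neg fun h => hj ⟨j, h⟩
  · simp only [chainProdFactor_inr m d e hloop, inflFactor, Sum.elim_inr]
    rw [(List.nodup_finRange m).prod_map_eq_single i _ (fun x _ hx => if_neg (Ne.symm hx))
      (List.mem_finRange i), if_pos rfl]
    have hi := hloop i
    have hgen : genFactor (inflGraph m d e) (Sum.inl u) (Sum.inr (i, t)) =
        if ((e i).1 = u ∧ (t : ℕ) = 0) ∨ ((e i).2 = u ∧ (t : ℕ) = 2 * d - 1)
          then pauliMat Pauli.Z else 1 := by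
      simp only [genFactor, inflGraph, SimpleGraph.fromRel_adj, inflAdj]
      simp only [reduceCtorEq, if_false, ne_eq, not_false_eq_true, true_and, false_or]
      split_ifs <;> rfl
    rw [hgen]
    by_cases hz : ((e i).1 = u ∧ (t : ℕ) = 0) ∨ ((e i).2 = u ∧ (t : ℕ) = 2 * d - 1)
    · have hx : (if (t : ℕ) % 2 = 1 then (e i).1 else (e i).2) ≠ u := by
        rcases hz with ⟨rfl, h0⟩ | ⟨rfl, h0⟩
        · rw [if_neg (by omega)]
          exact hi.symm
        · rw [if_pos (by omega)]
          exact hi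
      rw [if_pos hz, if_neg hx, if_neg hx, pauliMat_mul_self]
    · simp only [if_neg hz, one_mul]

theorem inflGen_commute {V : Type} [Fintype V] [DecidableEq V] (m d : ℕ) (hd : 0 < d)
    (e : Fin m → V × V) (hloop : ∀ j, (e j).1 ≠ (e j).2) (hinj : Function.Injective e)
    (hor : ∀ j j', e j ≠ ((e j').2, (e j').1)) (u v : V) :
    Commute (inflGen m d e u) (inflGen m d e v) := by
  have h := (graphGen_commute (origGraph m e) u v).eq
  rw [graphGen_eq_matTensor, graphGen_eq_matTensor, ← map_mul, ← map_mul,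
    ← one_smul ℂ (matTensor (genFactor (origGraph m e) v * _))] at h
  rw [commute_iff_eq, inflGen_eq_matTensor m d hd e hloop hinj hor,
    inflGen_eq_matTensor m d hd e hloop hinj hor, ← map_mul, ← map_mul]
  refine Eq.trans ?_ ((matTensor_sumElim_congr h
    (fun q => inflFactor m d e u (Sum.inr q) * inflFactor m d e v (Sum.inr q))).trans
    ((one_smul ℂ _).trans ?_))
  · congr 1
    funext w
    rcases w with w | q <;> rfl
  · congr 1
    funext w
    rcases w with w | q
    · rfl
    · simp only [Sum.elim_inr, Pi.mul_apply, inflFactor]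
      split_ifs <;> simp

theorem inflGen_mul_self {V : Type} [Fintype V] [DecidableEq V] (m d : ℕ) (hd : 0 < d)
    (e : Fin m → V × V) (hloop : ∀ j, (e j).1 ≠ (e j).2) (hinj : Function.Injective e)
    (hor : ∀ j j', e j ≠ ((e j').2, (e j').1)) (u : V) :
    inflGen m d e u * inflGen m d e u = 1 := by
  rw [inflGen_eq_matTensor m d hd e hloop hinj hor, ← map_mul, ← map_one matTensor]
  congr 1
  funext w
  rcases w with w | q
  · exact pauliMat_mul_self _
  · simp only [Pi.mul_apply, inflFactor, Sum.elim_inr]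
    by_cases hq : (if (q.2 : ℕ) % 2 = 1 then (e q.1).1 else (e q.1).2) = u
    · rw [if_pos hq]
      exact pauliMat_mul_self _
    · rw [if_neg hq]
      exact mul_one _

/-- The Pauli factors of the inflated submeasurement obtained from `σ` and generator set `U`. -/
def inflSub {V : Type} [DecidableEq V] {m d : ℕ} (e : Fin m → V × V) (σ : V → Pauli)
    (U : Finset V) : (V ⊕ (Fin m × Fin (2 * d))) → Pauli :=
  Sum.elim σ (fun q =>
    if (if (q.2 : ℕ) % 2 = 1 then (e q.1).1 else (e q.1).2) ∈ U then Pauli.X else Pauli.I)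

theorem inflGen_prod_eq {V : Type} [Fintype V] [LinearOrder V] (m d : ℕ) (hd : 0 < d)
    (e : Fin m → V × V) (hloop : ∀ j, (e j).1 ≠ (e j).2) (hinj : Function.Injective e)
    (hor : ∀ j j', e j ≠ ((e j').2, (e j').1)) (σ : V → Pauli) (U : Finset V) (c : ℂ)
    (h : ((U.sort (· ≤ ·)).map (graphGen (origGraph m e))).prod = c • pauliProd σ) :
    ((U.sort (· ≤ ·)).map (inflGen m d e)).prod = c • pauliProd (inflSub e σ U) := by
  rw [show graphGen (origGraph m e) = fun u => matTensor (genFactor (origGraph m e) u) from rfl,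
    matTensor_list_prod, pauliProd_eq_matTensor] at h
  rw [show inflGen m d e = fun u => matTensor (inflFactor m d e u) from
    funext (inflGen_eq_matTensor m d hd e hloop hinj hor), matTensor_list_prod,
    pauliProd_eq_matTensor]
  refine Eq.trans ?_ ((matTensor_sumElim_congr h
    (fun q => pauliMat (inflSub e σ U (Sum.inr q)))).trans ?_)
  · congr 1
    funext w
    rcases w with w | q
    · rfl
    · simp only [inflFactor, Sum.elim_inr, (Finset.sort_nodup U _).prod_map_ite_eq,
        Finset.mem_sort, inflSub]
      split_ifs <;> rfl
  · congr 2
    funext w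
    rcases w with w | q <;> rfl

theorem even_card_mem {V : Type} [DecidableEq V] {N : ℕ} (M : Fin N → V → Pauli)
    (U : Fin N → Finset V) (v : V)
    (heven : ∀ σ : Pauli, σ ≠ Pauli.I → Even (Finset.univ.filter (fun k => M k v = σ)).card)
    (hU : ∀ k, v ∈ U k ↔ (M k v).flip = 1) :
    Even (Finset.univ.filter (fun k => v ∈ U k)).card := by
  have h : Finset.univ.filter (fun k => v ∈ U k) =
      Finset.univ.filter (fun k => M k v = Pauli.X) ∪
        Finset.univ.filter (fun k => M k v = Pauli.Y) := by
    ext k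
    simp only [Finset.mem_filter, Finset.mem_univ, true_and, Finset.mem_union, hU]
    cases M k v <;> simp [Pauli.flip]
  rw [h, Finset.card_union_of_disjoint]
  · exact (heven _ (by simp)).add (heven _ (by simp))
  · rw [Finset.disjoint_filter]
    intro k _ h1 h2
    simp [h1] at h2

/-- Lemma 3: from measurements `M k = χ k • S k` on the original graph satisfying
the even-occurrence condition and `∏ χ k = -1`, the inflated submeasurements
`C' k = χ k • S' k` (a) are submeasurements of the inflated measurements,
(b) satisfy even occurrence at every vertex of the inflated graph, and
(c) multiply to `-𝟙`. -/
theorem stmt11 {V : Type} [Fintype V] [LinearOrder V] (m d N : ℕ) (hd : 0 < d)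
    (e : Fin m → V × V)
    (hloop : ∀ j, (e j).1 ≠ (e j).2)
    (hinj : Function.Injective e)
    (hor : ∀ j j', e j ≠ ((e j').2, (e j').1))
    (M : Fin N → V → Pauli) (χ : Fin N → ℤ) (U : Fin N → Finset V)
    (hχ : ∀ k, χ k = 1 ∨ χ k = -1)
    (heven : ∀ (v : V) (σ : Pauli), σ ≠ Pauli.I →
      Even (Finset.univ.filter (fun k => M k v = σ)).card)
    (hstab : ∀ k, pauliProd (M k) =
      (χ k : ℂ) • (((U k).sort (· ≤ ·)).map (graphGen (origGraph m e))).prod)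
    (hprod : (∏ k, χ k) = -1) :
    ∃ σ' : Fin N → (V ⊕ (Fin m × Fin (2 * d))) → Pauli,
      (∀ k, (((U k).sort (· ≤ ·)).map (inflGen m d e)).prod = (χ k : ℂ) • pauliProd (σ' k)) ∧
      (∀ k w, σ' k w = Pauli.I ∨ σ' k w = inflMeas (M k) w) ∧
      (∀ (w : V ⊕ (Fin m × Fin (2 * d))) (p : Pauli), p ≠ Pauli.I →
        Even (Finset.univ.filter (fun k => σ' k w = p)).card) ∧
      ((List.finRange N).map (fun k =>
        (χ k : ℂ) • (((U k).sort (· ≤ ·)).map (inflGen m d e)).prod)).prod = -1 := by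
  have hχsq : ∀ k, (χ k : ℂ) * (χ k : ℂ) = 1 := fun k => by
    rcases hχ k with h | h <;> simp [h]
  have hmem : ∀ v k, v ∈ U k ↔ (M k v).flip = 1 := fun v k =>
    mem_iff_flip_of_pauliProd_eq (origGraph m e) (U k) (M k) (χ k) (hstab k) v
  have hevenU : ∀ v, Even (Finset.univ.filter (fun k => v ∈ U k)).card := fun v =>
    even_card_mem M U v (heven v) (hmem v)
  refine ⟨fun k => inflSub e (M k) (U k), fun k => ?_, fun k w => ?_, fun w p hp => ?_, ?_⟩
  · refine inflGen_prod_eq m d hd e hloop hinj hor (M k) (U k) (χ k) ?_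
    rw [hstab k, smul_smul, hχsq, one_smul]
  · rcases w with v | q
    · exact Or.inr rfl
    · simp only [inflSub, inflMeas, Sum.elim_inr]
      split_ifs <;> simp
  · rcases w with v | q
    · exact heven v p hp
    · have h := hevenU (if (q.2 : ℕ) % 2 = 1 then (e q.1).1 else (e q.1).2)
      by_cases hX : p = Pauli.X
      · convert h using 4 with k
        simp only [inflSub, Sum.elim_inr, hX]
        by_cases hk : (if (q.2 : ℕ) % 2 = 1 then (e q.1).1 else (e q.1).2) ∈ U k <;> simp [hk]
      · rw [Finset.filter_false_of_mem]
        · simp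
        · intro k _
          simp only [inflSub, Sum.elim_inr]
          by_cases hk : (if (q.2 : ℕ) % 2 = 1 then (e q.1).1 else (e q.1).2) ∈ U k
          · rw [if_pos hk]
            exact Ne.symm hX
          · rw [if_neg hk]
            exact Ne.symm hp
  · rw [List.prod_map_smul_matrix, prod_commuting_involutions (inflGen m d e)
      (inflGen_commute m d hd e hloop hinj hor) (inflGen_mul_self m d hd e hloop hinj hor) U hevenU,
      ← List.ofFn_eq_map, List.prod_ofFn, ← Int.cast_prod, hprod]
    simp
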